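/- Let L₁ and L₂ be finite separable extensions of a field K whose Galois closures E₁ and E₂ satisfy E₁ ∩ E₂ = K, let L = L₁L₂, let M_i be the maximal abelian extension of K contained in L_i (i = 1, 2), and let M be the maximal abelian extension of K contained in L. Then: M = M₁M₂; the natural map Gal(M/K) → Gal(M/M₂) × Gal(M/M₁) (equivalently, Gal(M/K) ≅ Gal(M₁/K) × Gal(M₂/K)) is an isomorphism; and for i = 1, 2 the maximal abelian extension of L_i contained in L is L_i M_{3−i}. -/

import Mathlib

open IntermediateField

variable {K Ω : Type*} [Field K] [Field Ω] [Algebra K Ω]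

/-- `E` is the Galois closure of `L` over `K`: the smallest Galois extension
of `K` containing `L`. -/
def IsGaloisClosure (L E : IntermediateField K Ω) : Prop :=
  L ≤ E ∧ IsGalois K ↥E ∧
    ∀ E' : IntermediateField K Ω, L ≤ E' → IsGalois K ↥E' → E ≤ E'

/-- `M` is the maximal abelian extension of `K` contained in `L`. -/
def IsMaximalAbelianSubextension (M L : IntermediateField K Ω) : Prop :=
  M ≤ L ∧ IsGalois K ↥M ∧ (∀ σ τ : ↥M ≃ₐ[K] ↥M, σ * τ = τ * σ) ∧
    ∀ M' : IntermediateField K Ω, M' ≤ L → IsGalois K ↥M' →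
      (∀ σ τ : ↥M' ≃ₐ[K] ↥M', σ * τ = τ * σ) → M' ≤ M

/-- `F` is the maximal extension of `Lb` contained in `L` which is abelian over `Lb`. -/
def IsMaximalAbelianOver (Lb F L : IntermediateField K Ω) : Prop :=
  ∃ h : Lb ≤ F, F ≤ L ∧
    (letI := ((inclusion h).toRingHom).toAlgebra;
      IsGalois ↥Lb ↥F ∧ ∀ σ τ : (↥F ≃ₐ[↥Lb] ↥F), σ * τ = τ * σ) ∧
    ∀ F' : IntermediateField K Ω, ∀ h' : Lb ≤ F', F' ≤ L →
      (letI := ((inclusion h').toRingHom).toAlgebra;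
        IsGalois ↥Lb ↥F' ∧ ∀ σ τ : (↥F' ≃ₐ[↥Lb] ↥F'), σ * τ = τ * σ) → F' ≤ F

open scoped commutatorElement

namespace Subgroup

variable {G : Type*} [Group G]

theorem commutator_top_le_sup_commutator {N₁ N₂ : Subgroup G} [N₂.Normal] (h : N₁ ⊔ N₂ = ⊤) :
    ⁅(⊤ : Subgroup G), (⊤ : Subgroup G)⁆ ≤ ⁅N₁, N₁⁆ ⊔ N₂ := by
  have hN : map (QuotientGroup.mk' N₂) ⊤ = map (QuotientGroup.mk' N₂) N₁ := by
    rw [← h, map_sup, sup_eq_left]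
    simp
  have hle : map (QuotientGroup.mk' N₂) ⁅(⊤ : Subgroup G), (⊤ : Subgroup G)⁆ ≤
      map (QuotientGroup.mk' N₂) ⁅N₁, N₁⁆ := by
    rw [map_commutator, map_commutator, hN]
  simpa using map_le_map_iff.1 hle

theorem inf_sup_commutator_top_le {N₁ N₂ H₁ H₂ : Subgroup G} [N₂.Normal] (h : N₁ ⊔ N₂ = ⊤)
    (h₁ : N₁ ≤ H₁) (h₂ : N₂ ≤ H₂) :
    H₁ ⊓ (H₂ ⊔ ⁅(⊤ : Subgroup G), (⊤ : Subgroup G)⁆) ≤ (H₁ ⊓ H₂) ⊔ ⁅H₁, H₁⁆ := by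
  rintro g ⟨hg, hg'⟩
  obtain ⟨k, hk, c, hc, rfl⟩ := mem_sup_of_normal_right.1 hg'
  obtain ⟨d, hd, n, hn, rfl⟩ :=
    mem_sup_of_normal_right.1 (commutator_top_le_sup_commutator h hc)
  have hd' : d ∈ ⁅H₁, H₁⁆ := commutator_mono h₁ h₁ hd
  have hdH : d ∈ H₁ := commutator_le_self H₁ hd'
  have hconj : d * n * d⁻¹ ∈ H₂ := h₂ (Normal.conj_mem inferInstance n hn d)
  have heq : k * (d * n) = k * (d * n * d⁻¹) * d := by group
  rw [heq] at hg ⊢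
  exact mul_mem_sup ⟨(mul_mem_cancel_right hdH).1 hg, mul_mem hk hconj⟩ hd'

theorem sup_commutator_top_inf_le {N₁ N₂ H₁ H₂ : Subgroup G} [N₂.Normal] (h : N₁ ⊔ N₂ = ⊤)
    (h₁ : N₁ ≤ H₁) (h₂ : N₂ ≤ H₂) :
    (H₁ ⊔ ⁅(⊤ : Subgroup G), (⊤ : Subgroup G)⁆) ⊓
        (H₂ ⊔ ⁅(⊤ : Subgroup G), (⊤ : Subgroup G)⁆) ≤
      (H₁ ⊓ H₂) ⊔ ⁅(⊤ : Subgroup G), (⊤ : Subgroup G)⁆ := by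
  rintro g ⟨hg, hg'⟩
  obtain ⟨k, hk, c, hc, rfl⟩ := mem_sup_of_normal_right.1 hg
  have hc' : c ∈ H₂ ⊔ ⁅(⊤ : Subgroup G), (⊤ : Subgroup G)⁆ := le_sup_right (a := H₂) hc
  have hk' := inf_sup_commutator_top_le h h₁ h₂ ⟨hk, (mul_mem_cancel_right hc').1 hg'⟩
  exact mul_mem (sup_le_sup_left (commutator_mono le_top le_top) _ hk')
    (le_sup_right (a := H₁ ⊓ H₂) hc)

end Subgroup

section AbelianSubextensions

variable {k F : Type*} [Field k] [Field F] [Algebra k F] [Algebra k Ω] [Algebra F Ω]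
  [IsScalarTower k F Ω]

theorem isGalois_and_comm_iff [IsGalois k Ω] :
    (IsGalois k F ∧ ∀ σ τ : F ≃ₐ[k] F, σ * τ = τ * σ) ↔
      ∀ (σ τ : Ω ≃ₐ[k] Ω) (x : F), ⁅σ, τ⁆ (algebraMap F Ω x) = algebraMap F Ω x := by
  constructor
  · rintro ⟨_, hcomm⟩ σ τ x
    have h : AlgEquiv.restrictNormalHom F ⁅σ, τ⁆ = 1 := by
      rw [map_commutatorElement, commutatorElement_eq_one_iff_mul_comm]
      exact hcomm _ _
    rw [← AlgEquiv.restrictNormal_commutes]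
    exact congrArg (algebraMap F Ω) (DFunLike.congr_fun h x)
  · intro h
    have hR : (IsScalarTower.toAlgHom k F Ω).fieldRange.fixingSubgroup.Normal := by
      refine ⟨fun τ hτ σ => ?_⟩
      rw [IntermediateField.mem_fixingSubgroup_iff] at hτ ⊢
      rintro _ ⟨x, rfl⟩
      have hx := h σ τ x
      have hτ' : τ⁻¹ (algebraMap F Ω x) = algebraMap F Ω x := by
        rw [AlgEquiv.aut_inv, AlgEquiv.symm_apply_eq]
        exact (hτ _ ⟨x, rfl⟩).symm
      rw [commutatorElement_def, AlgEquiv.mul_apply, hτ'] at hx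
      exact hx
    have hG : IsGalois k F :=
      ((AlgEquiv.ofBijective (IsScalarTower.toAlgHom k F Ω).rangeRestrict
        ⟨RingHom.injective _, AlgHom.rangeRestrict_surjective _⟩).transfer_galois
          (E' := (IsScalarTower.toAlgHom k F Ω).fieldRange)).mpr
        ((InfiniteGalois.normal_iff_isGalois _).mp hR)
    refine ⟨hG, fun σ τ => ?_⟩
    obtain ⟨σ, rfl⟩ := AlgEquiv.restrictNormalHom_surjective (F := k) (E := Ω) (K₁ := F) σ
    obtain ⟨τ, rfl⟩ := AlgEquiv.restrictNormalHom_surjective (F := k) (E := Ω) (K₁ := F) τ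
    rw [← commutatorElement_eq_one_iff_mul_comm, ← map_commutatorElement]
    ext x
    apply (algebraMap F Ω).injective
    exact (AlgEquiv.restrictNormal_commutes ⁅σ, τ⁆ F x).trans (h σ τ x)

theorem isGalois_and_comm_iff_le_fixedField [IsGalois K Ω] (M : IntermediateField K Ω) :
    (IsGalois K M ∧ ∀ σ τ : M ≃ₐ[K] M, σ * τ = τ * σ) ↔
      M ≤ fixedField ⁅(⊤ : Subgroup (Ω ≃ₐ[K] Ω)), (⊤ : Subgroup (Ω ≃ₐ[K] Ω))⁆ := by
  rw [isGalois_and_comm_iff (Ω := Ω), le_iff_le, Subgroup.commutator_le]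
  simp only [IntermediateField.mem_fixingSubgroup_iff, Subtype.forall, Subgroup.mem_top, true_imp_iff]
  rfl

theorem isGalois_and_comm_over_iff_le_fixedField [IsGalois K Ω] {L F : IntermediateField K Ω}
    (h : L ≤ F) :
    (letI := ((inclusion h).toRingHom).toAlgebra;
      IsGalois L F ∧ ∀ σ τ : F ≃ₐ[L] F, σ * τ = τ * σ) ↔
      F ≤ fixedField ⁅L.fixingSubgroup, L.fixingSubgroup⁆ := by
  let := ((inclusion h).toRingHom).toAlgebra
  have : IsScalarTower L F Ω := .of_algebraMap_eq fun _ => rfl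
  rw [isGalois_and_comm_iff (Ω := Ω), le_iff_le, Subgroup.commutator_le]
  simp only [IntermediateField.mem_fixingSubgroup_iff F]
  constructor
  · intro H σ hσ τ hτ x hx
    exact H (fixingSubgroupEquiv L ⟨σ, hσ⟩) (fixingSubgroupEquiv L ⟨τ, hτ⟩) ⟨x, hx⟩
  · intro H σ τ x
    exact H _ ((fixingSubgroupEquiv L).symm σ).2 _ ((fixingSubgroupEquiv L).symm τ).2 x x.2

theorem IsMaximalAbelianSubextension.eq_inf_fixedField [IsGalois K Ω]
    {M L : IntermediateField K Ω} (hM : IsMaximalAbelianSubextension M L) :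
    M = L ⊓ fixedField ⁅(⊤ : Subgroup (Ω ≃ₐ[K] Ω)), (⊤ : Subgroup (Ω ≃ₐ[K] Ω))⁆ := by
  obtain ⟨hle, hgal, hcomm, hmax⟩ := hM
  refine le_antisymm
    (le_inf hle ((isGalois_and_comm_iff_le_fixedField M).1 ⟨hgal, hcomm⟩)) ?_
  obtain ⟨hgal', hcomm'⟩ := (isGalois_and_comm_iff_le_fixedField _).2
    (inf_le_right (a := L) (b := fixedField ⁅(⊤ : Subgroup (Ω ≃ₐ[K] Ω)), ⊤⁆))
  exact hmax _ inf_le_left hgal' hcomm'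

theorem isMaximalAbelianOver_of_eq [IsGalois K Ω] {L₀ F L : IntermediateField K Ω} (h : L₀ ≤ F)
    (hF : F = L ⊓ fixedField ⁅L₀.fixingSubgroup, L₀.fixingSubgroup⁆) :
    IsMaximalAbelianOver L₀ F L :=
  ⟨h, hF.le.trans inf_le_left,
    (isGalois_and_comm_over_iff_le_fixedField h).2 (hF.le.trans inf_le_right),
    fun _ h' hle hab =>
      (le_inf hle ((isGalois_and_comm_over_iff_le_fixedField h').1 hab)).trans hF.ge⟩

end AbelianSubextensions

theorem IsGaloisClosure.finiteDimensional [IsGalois K Ω] {L E : IntermediateField K Ω}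
    [FiniteDimensional K L] (h : IsGaloisClosure L E) : FiniteDimensional K E :=
  have hle : E ≤ normalClosure K L Ω := h.2.2 _ L.le_normalClosure inferInstance
  FiniteDimensional.of_injective (inclusion hle).toLinearMap (inclusion_injective hle)

theorem fixedField_sup (H₁ H₂ : Subgroup (Ω ≃ₐ[K] Ω)) :
    fixedField (H₁ ⊔ H₂) = fixedField H₁ ⊓ fixedField H₂ :=
  eq_of_forall_le_iff fun F => by simp only [le_iff_le, sup_le_iff, le_inf_iff]

theorem fixingSubgroup_fixedField_of_fixingSubgroup_le [IsGalois K Ω] {L : IntermediateField K Ω}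
    [FiniteDimensional K L] {H : Subgroup (Ω ≃ₐ[K] Ω)} (h : L.fixingSubgroup ≤ H) :
    (fixedField H).fixingSubgroup = H :=
  InfiniteGalois.fixingSubgroup_fixedField
    ⟨H, Subgroup.isClosed_of_isOpen _ (Subgroup.isOpen_mono h L.fixingSubgroup_isOpen)⟩

theorem fixingSubgroup_inf_fixedField [IsGalois K Ω] (L : IntermediateField K Ω)
    [FiniteDimensional K L] (H : Subgroup (Ω ≃ₐ[K] Ω)) :
    (L ⊓ fixedField H).fixingSubgroup = L.fixingSubgroup ⊔ H := by
  rw [← fixingSubgroup_fixedField_of_fixingSubgroup_le (L := L) le_sup_left, fixedField_sup,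
    InfiniteGalois.fixedField_fixingSubgroup]

theorem fixingSubgroup_sup_fixingSubgroup_eq_top [IsGalois K Ω] {E₁ E₂ : IntermediateField K Ω}
    [FiniteDimensional K E₁] (h : E₁ ⊓ E₂ = ⊥) : E₁.fixingSubgroup ⊔ E₂.fixingSubgroup = ⊤ := by
  rw [← fixingSubgroup_inf_fixedField, InfiniteGalois.fixedField_fixingSubgroup, h,
    fixingSubgroup_bot]

theorem le_of_fixingSubgroup_le [IsGalois K Ω] {F F' : IntermediateField K Ω}
    (h : F'.fixingSubgroup ≤ F.fixingSubgroup) : F ≤ F' := by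
  rw [← InfiniteGalois.fixedField_fixingSubgroup F']
  exact (le_iff_le _ _).2 h

section Compositum

variable [IsGalois K Ω] {L₁ L₂ E₁ E₂ : IntermediateField K Ω} [FiniteDimensional K L₁]
  [FiniteDimensional K L₂] [FiniteDimensional K E₁] [IsGalois K E₂]

theorem sup_inf_fixedField_commutator_top (h₁ : L₁ ≤ E₁) (h₂ : L₂ ≤ E₂) (h : E₁ ⊓ E₂ = ⊥) :
    (L₁ ⊔ L₂) ⊓ fixedField ⁅(⊤ : Subgroup (Ω ≃ₐ[K] Ω)), (⊤ : Subgroup (Ω ≃ₐ[K] Ω))⁆ =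
      L₁ ⊓ fixedField ⁅(⊤ : Subgroup (Ω ≃ₐ[K] Ω)), (⊤ : Subgroup (Ω ≃ₐ[K] Ω))⁆ ⊔
        L₂ ⊓ fixedField ⁅(⊤ : Subgroup (Ω ≃ₐ[K] Ω)), (⊤ : Subgroup (Ω ≃ₐ[K] Ω))⁆ := by
  have := (InfiniteGalois.normal_iff_isGalois E₂).2 inferInstance
  refine le_antisymm (le_of_fixingSubgroup_le ?_)
    (sup_le (inf_le_inf_right _ le_sup_left) (inf_le_inf_right _ le_sup_right))
  rw [fixingSubgroup_sup, fixingSubgroup_inf_fixedField, fixingSubgroup_inf_fixedField,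
    fixingSubgroup_inf_fixedField, fixingSubgroup_sup]
  exact Subgroup.sup_commutator_top_inf_le (fixingSubgroup_sup_fixingSubgroup_eq_top h)
    (fixingSubgroup_antitone h₁) (fixingSubgroup_antitone h₂)

theorem sup_inf_fixedField_commutator_top_eq (h₁ : L₁ ≤ E₁) (h₂ : L₂ ≤ E₂) (h : E₁ ⊓ E₂ = ⊥) :
    L₁ ⊔ L₂ ⊓ fixedField ⁅(⊤ : Subgroup (Ω ≃ₐ[K] Ω)), (⊤ : Subgroup (Ω ≃ₐ[K] Ω))⁆ =
      (L₁ ⊔ L₂) ⊓ fixedField ⁅L₁.fixingSubgroup, L₁.fixingSubgroup⁆ := by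
  have := (InfiniteGalois.normal_iff_isGalois E₂).2 inferInstance
  refine le_antisymm (sup_le (le_inf le_sup_left ?_) (inf_le_inf le_sup_right ?_))
    (le_of_fixingSubgroup_le ?_)
  · exact (le_iff_le _ _).2 (Subgroup.commutator_le_self _)
  · exact fixedField_antitone (Subgroup.commutator_mono le_top le_top)
  rw [fixingSubgroup_sup, fixingSubgroup_inf_fixedField, fixingSubgroup_inf_fixedField,
    fixingSubgroup_sup]
  exact Subgroup.inf_sup_commutator_top_le (fixingSubgroup_sup_fixingSubgroup_eq_top h)
    (fixingSubgroup_antitone h₁) (fixingSubgroup_antitone h₂)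

end Compositum

/-- For `M` the compositum of Galois extensions `M₁` and `M₂` with trivial intersection,
the restriction maps identify `Gal(M/K)` with `Gal(M₁/K) × Gal(M₂/K)`. -/
theorem exists_mulEquiv_prod_of_inf_eq_bot [IsGalois K Ω] {M₁ M₂ M : IntermediateField K Ω}
    [FiniteDimensional K M₁] [IsGalois K M₁] [IsGalois K M₂] [IsGalois K M]
    (hinf : M₁ ⊓ M₂ = ⊥) (hsup : M = M₁ ⊔ M₂) (h₁ : M₁ ≤ M) (h₂ : M₂ ≤ M) :
    ∃ φ : (M ≃ₐ[K] M) ≃* (M₁ ≃ₐ[K] M₁) × (M₂ ≃ₐ[K] M₂),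
      ∀ σ : M ≃ₐ[K] M,
        (∀ x : M₁, (((φ σ).1 x : M₁) : Ω) = ((σ (inclusion h₁ x) : M) : Ω)) ∧
        (∀ y : M₂, (((φ σ).2 y : M₂) : Ω) = ((σ (inclusion h₂ y) : M) : Ω)) := by
  let := ((inclusion h₁).toRingHom).toAlgebra
  let := ((inclusion h₂).toRingHom).toAlgebra
  have : IsScalarTower K M₁ M := .of_algebraMap_eq fun _ => rfl
  have : IsScalarTower K M₂ M := .of_algebraMap_eq fun _ => rfl
  let f : (M ≃ₐ[K] M) →* (M₁ ≃ₐ[K] M₁) × (M₂ ≃ₐ[K] M₂) :=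
    (AlgEquiv.restrictNormalHom M₁).prod (AlgEquiv.restrictNormalHom M₂)
  have hf₁ (σ : M ≃ₐ[K] M) (x : M₁) : (((f σ).1 x : M₁) : Ω) = ((σ (inclusion h₁ x) : M) : Ω) :=
    congrArg Subtype.val (AlgEquiv.restrictNormal_commutes σ M₁ x)
  have hf₂ (σ : M ≃ₐ[K] M) (x : M₂) : (((f σ).2 x : M₂) : Ω) = ((σ (inclusion h₂ x) : M) : Ω) :=
    congrArg Subtype.val (AlgEquiv.restrictNormal_commutes σ M₂ x)
  have hlift (σ : Ω ≃ₐ[K] Ω) (x : M) : ((AlgEquiv.restrictNormalHom M σ x : M) : Ω) = σ x :=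
    AlgEquiv.restrictNormalHom_apply M σ x
  have hinj : Function.Injective f := by
    rw [injective_iff_map_eq_one]
    intro σ hσ
    obtain ⟨s, rfl⟩ := AlgEquiv.restrictNormalHom_surjective (F := K) (E := Ω) (K₁ := M) σ
    have hs : s ∈ (M₁ ⊔ M₂).fixingSubgroup := by
      rw [fixingSubgroup_sup]
      refine ⟨(IntermediateField.mem_fixingSubgroup_iff _ _).2 fun x hx => ?_,
        (IntermediateField.mem_fixingSubgroup_iff _ _).2 fun x hx => ?_⟩
      · have := hf₁ (AlgEquiv.restrictNormalHom M s) ⟨x, hx⟩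
        rw [hσ, hlift] at this
        exact this.symm
      · have := hf₂ (AlgEquiv.restrictNormalHom M s) ⟨x, hx⟩
        rw [hσ, hlift] at this
        exact this.symm
    ext x
    rw [hlift]
    exact (IntermediateField.mem_fixingSubgroup_iff _ _).1 hs x (hsup ▸ x.2)
  have hsurj : Function.Surjective f := by
    rintro ⟨σ₁, σ₂⟩
    obtain ⟨s₁, rfl⟩ := AlgEquiv.restrictNormalHom_surjective (F := K) (E := Ω) (K₁ := M₁) σ₁
    obtain ⟨s₂, rfl⟩ := AlgEquiv.restrictNormalHom_surjective (F := K) (E := Ω) (K₁ := M₂) σ₂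
    have := (InfiniteGalois.normal_iff_isGalois M₂).2 inferInstance
    have hmem : s₁⁻¹ * s₂ ∈ M₁.fixingSubgroup ⊔ M₂.fixingSubgroup := by
      rw [fixingSubgroup_sup_fixingSubgroup_eq_top hinf]
      trivial
    obtain ⟨a, ha, b, hb, hab⟩ := Subgroup.mem_sup_of_normal_right.1 hmem
    rw [IntermediateField.mem_fixingSubgroup_iff] at ha hb
    have hs : s₁ * a * b = s₂ := by rw [mul_assoc, hab, mul_inv_cancel_left]
    refine ⟨AlgEquiv.restrictNormalHom M (s₁ * a), Prod.ext ?_ ?_⟩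
    · ext x
      rw [hf₁, hlift]
      refine Eq.trans ?_ (AlgEquiv.restrictNormalHom_apply M₁ s₁ x).symm
      exact congrArg s₁ (ha x x.2)
    · ext x
      rw [hf₂, hlift]
      refine Eq.trans ?_ (AlgEquiv.restrictNormalHom_apply M₂ s₂ x).symm
      rw [← hs]
      exact congrArg (s₁ * a) (hb x x.2).symm
  exact ⟨MulEquiv.ofBijective f ⟨hinj, hsurj⟩, fun σ => ⟨hf₁ σ, hf₂ σ⟩⟩

/-- Let `L₁, L₂` be finite separable extensions of `K` whose Galois closures `E₁, E₂`
satisfy `E₁ ∩ E₂ = K`, let `L = L₁L₂`, let `Mᵢ` be the maximal abelian extension of `K`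
contained in `Lᵢ` (`i = 1, 2`), and let `M` be the maximal abelian extension of `K`
contained in `L`.  Then `M = M₁M₂`; the natural map
`Gal(M/K) → Gal(M₁/K) × Gal(M₂/K)` is an isomorphism; and for `i = 1, 2` the maximal
abelian extension of `Lᵢ` contained in `L` is `Lᵢ M₍₃₋ᵢ₎`. -/
theorem maximal_abelian_subextensions
    (K Ω : Type*) [Field K] [Field Ω] [Algebra K Ω] [IsSepClosure K Ω]
    (L₁ L₂ E₁ E₂ M₁ M₂ M : IntermediateField K Ω)
    [FiniteDimensional K ↥L₁] [FiniteDimensional K ↥L₂]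
    [Algebra.IsSeparable K ↥L₁] [Algebra.IsSeparable K ↥L₂]
    (hE₁ : IsGaloisClosure L₁ E₁) (hE₂ : IsGaloisClosure L₂ E₂)
    (hdisj : E₁ ⊓ E₂ = ⊥)
    (hM₁ : IsMaximalAbelianSubextension M₁ L₁)
    (hM₂ : IsMaximalAbelianSubextension M₂ L₂)
    (hM : IsMaximalAbelianSubextension M (L₁ ⊔ L₂)) :
    M = M₁ ⊔ M₂ ∧
    (∀ (h₁ : M₁ ≤ M) (h₂ : M₂ ≤ M),
      ∃ φ : (↥M ≃ₐ[K] ↥M) ≃* (↥M₁ ≃ₐ[K] ↥M₁) × (↥M₂ ≃ₐ[K] ↥M₂),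
        ∀ σ : ↥M ≃ₐ[K] ↥M,
          (∀ x : ↥M₁, ((((φ σ).1 x : ↥M₁) : Ω)) = ((σ (inclusion h₁ x) : ↥M) : Ω)) ∧
          (∀ y : ↥M₂, ((((φ σ).2 y : ↥M₂) : Ω)) = ((σ (inclusion h₂ y) : ↥M) : Ω))) ∧
    IsMaximalAbelianOver L₁ (L₁ ⊔ M₂) (L₁ ⊔ L₂) ∧
    IsMaximalAbelianOver L₂ (L₂ ⊔ M₁) (L₁ ⊔ L₂) := by
  have hfin₁ : FiniteDimensional K E₁ := hE₁.finiteDimensional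
  have hfin₂ : FiniteDimensional K E₂ := hE₂.finiteDimensional
  have hgal₁ : IsGalois K E₁ := hE₁.2.1
  have hgal₂ : IsGalois K E₂ := hE₂.2.1
  have hMsup : M = M₁ ⊔ M₂ := by
    rw [hM.eq_inf_fixedField, hM₁.eq_inf_fixedField, hM₂.eq_inf_fixedField,
      sup_inf_fixedField_commutator_top hE₁.1 hE₂.1 hdisj]
  refine ⟨hMsup, fun h₁ h₂ => ?_, isMaximalAbelianOver_of_eq le_sup_left ?_,
    isMaximalAbelianOver_of_eq le_sup_left ?_⟩
  · have : IsGalois K M₁ := hM₁.2.1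
    have : IsGalois K M₂ := hM₂.2.1
    have : IsGalois K M := hM.2.1
    have : FiniteDimensional K M₁ :=
      FiniteDimensional.of_injective (inclusion hM₁.1).toLinearMap (inclusion_injective hM₁.1)
    have hinf : M₁ ⊓ M₂ = ⊥ :=
      le_bot_iff.1 (hdisj ▸ inf_le_inf (hM₁.1.trans hE₁.1) (hM₂.1.trans hE₂.1))
    exact exists_mulEquiv_prod_of_inf_eq_bot hinf hMsup h₁ h₂
  · rw [hM₂.eq_inf_fixedField]
    exact sup_inf_fixedField_commutator_top_eq hE₁.1 hE₂.1 hdisj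
  · rw [hM₁.eq_inf_fixedField, sup_comm L₁]
    exact sup_inf_fixedField_commutator_top_eq hE₂.1 hE₁.1 (inf_comm E₁ E₂ ▸ hdisj)
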